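/- (L²(ν) smoothness of the semi-dual on bounded potentials) Assume the cost satisfies c(x,y) ≥ 0 for all (x,y), and let B > 0 with λ(B) := e^{2B} · E_{(x,y')∼μ⊗ν}[ exp(c(x,y')/ε) ] < ∞. Then for all φ, φ̄ ∈ L²(ν) with ‖φ‖_{L^∞(𝒴)} ≤ B and ‖φ̄‖_{L^∞(𝒴)} ≤ B, J(φ̄) − J(φ) − ⟨δJ(φ), φ̄ − φ⟩ ≥ − λ(B) · ‖φ̄ − φ‖²_{L²(ν)} / 2, where ⟨f,g⟩ := ∫_𝒴 f(y)g(y) dy and ‖f‖²_{L²(ν)} := ∫_𝒴 f(y)² dν(y). -/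

import Mathlib

open MeasureTheory

noncomputable section

variable {d : ℕ}

/-- `φ⁺(x) = log ∫ exp(φ(y) - c(x,y)/ε) dν(y)`, with `ν` the density of the marginal on `𝒴`. -/
def phiPlus (ν : (Fin d → ℝ) → ℝ) (c : (Fin d → ℝ) → (Fin d → ℝ) → ℝ) (ε : ℝ)
    (φ : (Fin d → ℝ) → ℝ) (x : Fin d → ℝ) : ℝ :=
  Real.log (∫ y, Real.exp (φ y - c x y / ε) * ν y)

/-- The semi-dual `J(φ) = ∫ φ dν - ∫ φ⁺ dμ`. -/
def semiDual (μ ν : (Fin d → ℝ) → ℝ) (c : (Fin d → ℝ) → (Fin d → ℝ) → ℝ) (ε : ℝ)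
    (φ : (Fin d → ℝ) → ℝ) : ℝ :=
  (∫ y, φ y * ν y) - ∫ x, phiPlus ν c ε φ x * μ x

/-- The joint density `π(φ, φ⁺)(x,y) = exp(φ(y) - φ⁺(x) - c(x,y)/ε) μ(x) ν(y)`. -/
def piJoint (μ ν : (Fin d → ℝ) → ℝ) (c : (Fin d → ℝ) → (Fin d → ℝ) → ℝ) (ε : ℝ)
    (φ : (Fin d → ℝ) → ℝ) (z : (Fin d → ℝ) × (Fin d → ℝ)) : ℝ :=
  Real.exp (φ z.2 - phiPlus ν c ε φ z.1 - c z.1 z.2 / ε) * μ z.1 * ν z.2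

/-- The `𝒴`-marginal density of `π(φ, φ⁺)`. -/
def piY (μ ν : (Fin d → ℝ) → ℝ) (c : (Fin d → ℝ) → (Fin d → ℝ) → ℝ) (ε : ℝ)
    (φ : (Fin d → ℝ) → ℝ) (y : Fin d → ℝ) : ℝ :=
  ∫ x, piJoint μ ν c ε φ (x, y)

/-- First variation of the semi-dual: `δJ(φ) = ν - π(φ,φ⁺)_𝒴`. -/
def deltaJ (μ ν : (Fin d → ℝ) → ℝ) (c : (Fin d → ℝ) → (Fin d → ℝ) → ℝ) (ε : ℝ)
    (φ : (Fin d → ℝ) → ℝ) (y : Fin d → ℝ) : ℝ :=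
  ν y - piY μ ν c ε φ y

/-- `λ(B) = e^{2B} · E_{(x,y')∼μ⊗ν}[exp(c(x,y')/ε)]`. -/
def lamB (μ ν : (Fin d → ℝ) → ℝ) (c : (Fin d → ℝ) → (Fin d → ℝ) → ℝ) (ε B : ℝ) : ℝ :=
  Real.exp (2 * B) *
    ∫ z : (Fin d → ℝ) × (Fin d → ℝ), Real.exp (c z.1 z.2 / ε) * μ z.1 * ν z.2

lemma tilted_mul_sub_const {α : Type*} [MeasurableSpace α] (P : Measure α) (h : α → ℝ) (u m : ℝ) :
    P.tilted (fun a => u * (h a - m)) = P.tilted (fun a => u * h a) := by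
  unfold Measure.tilted
  congr 1
  funext a
  simp_rw [mul_sub, Real.exp_sub]
  rw [integral_div, div_div_div_cancel_right₀ (Real.exp_ne_zero _)]

/-- Second-order upper bound on the cumulant generating function of a bounded variable. -/
lemma log_integral_exp_sub_integral_le {α : Type*} [MeasurableSpace α] (P : Measure α)
    [IsProbabilityMeasure P] {h : α → ℝ} (hm : Measurable h) {M K : ℝ}
    (hM : ∀ᵐ a ∂P, |h a| ≤ M)
    (hK : ∀ u ∈ Set.Ioo (0 : ℝ) 1, ∫ a, h a ^ 2 ∂(P.tilted (fun a => u * h a)) ≤ K) :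
    Real.log (∫ a, Real.exp (h a) ∂P) - ∫ a, h a ∂P ≤ K / 2 := by
  set m := ∫ a, h a ∂P with hmdef
  have hint : Integrable h P :=
    Integrable.of_bound hm.aestronglyMeasurable M (by simpa [Real.norm_eq_abs] using hM)
  have hXb : ∀ᵐ a ∂P, h a - m ∈ Set.Icc (-M - m) (M - m) := by
    filter_upwards [hM] with a ha
    have := abs_le.1 ha
    constructor <;> linarith
  have hXm : Measurable fun a => h a - m := hm.sub_const m
  have hexp : ∀ t : ℝ, Integrable (fun a => Real.exp (t * (h a - m))) P := fun t =>
    ProbabilityTheory.integrable_exp_mul_of_mem_Icc hXm.aemeasurable hXb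
  have hset : ProbabilityTheory.integrableExpSet (fun a => h a - m) P = Set.univ := by
    ext t
    simpa [ProbabilityTheory.integrableExpSet] using hexp t
  have hmean : ∫ a, (h a - m) ∂P = 0 := by
    rw [integral_sub hint (integrable_const _)]
    simp [hmdef]
  obtain ⟨u, hu, hcgf⟩ := ProbabilityTheory.exists_cgf_eq_iteratedDeriv_two_cgf_mul
    (μ := P) (X := fun a => h a - m) (t := 1) one_pos hmean (by simp [hset])
  rw [← ProbabilityTheory.variance_tilted_mul (by simp [hset])] at hcgf
  have : IsProbabilityMeasure (P.tilted (fun a => u * (h a - m))) :=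
    isProbabilityMeasure_tilted (hexp u)
  rw [ProbabilityTheory.variance_sub_const hm.aestronglyMeasurable] at hcgf
  have hvar := ProbabilityTheory.variance_le_expectation_sq
    (μ := P.tilted (fun a => u * (h a - m))) hm.aestronglyMeasurable
  have hcgf' : ProbabilityTheory.cgf (fun a => h a - m) P 1 =
      Real.log (∫ a, Real.exp (h a) ∂P) - m := by
    have hne : (∫ a, Real.exp (h a) ∂P) ≠ 0 := by
      refine (integral_exp_pos ?_).ne'
      have := (hexp 1).mul_const (Real.exp m)
      simpa [← Real.exp_add] using this
    simp only [ProbabilityTheory.cgf, ProbabilityTheory.mgf, one_mul, Real.exp_sub]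
    rw [integral_div, Real.log_div hne (Real.exp_ne_zero _), Real.log_exp]
  rw [← hcgf', hcgf]
  have hKu := hK u hu
  rw [← tilted_mul_sub_const P h u m] at hKu
  simp only [Pi.pow_apply] at hvar
  linarith

/-- Jensen's inequality for `1 / x`, in exponential form. -/
lemma one_div_integral_exp_le {α : Type*} [MeasurableSpace α] (N : Measure α)
    [IsProbabilityMeasure N] {w : α → ℝ} (hwi : Integrable (fun a => Real.exp (w a)) N)
    (hwi' : Integrable (fun a => Real.exp (-w a)) N) :
    1 / (∫ a, Real.exp (w a) ∂N) ≤ ∫ a, Real.exp (-w a) ∂N := by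
  set A := ∫ a, Real.exp (w a) ∂N with hA
  have hApos : 0 < A := integral_exp_pos hwi
  have hle : ∫ a, (2 / A - Real.exp (w a) / A ^ 2) ∂N ≤ ∫ a, Real.exp (-w a) ∂N := by
    refine integral_mono ((integrable_const _).sub (hwi.div_const _)) hwi' fun a => ?_
    have hs := Real.exp_pos (w a)
    simp only [Real.exp_neg]
    have : (Real.exp (w a))⁻¹ - (2 / A - Real.exp (w a) / A ^ 2) =
        (A - Real.exp (w a)) ^ 2 / (Real.exp (w a) * A ^ 2) := by
      field_simp
      ring
    have : 0 ≤ (A - Real.exp (w a)) ^ 2 / (Real.exp (w a) * A ^ 2) := by positivity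
    linarith
  rw [integral_sub (integrable_const _) (hwi.div_const _), integral_div, integral_div, ← hA] at hle
  simp only [integral_const, probReal_univ, one_smul] at hle
  calc 1 / A = 2 / A - A / A ^ 2 := by field_simp; norm_num
    _ ≤ _ := hle

/-- Second-order upper bound on the soft-min of two bounded potentials. -/
lemma log_integral_exp_sub_log_integral_exp_le {α : Type*} [MeasurableSpace α] (N : Measure α)
    [IsProbabilityMeasure N] {f g w : α → ℝ} (hf : Measurable f) (hg : Measurable g)
    (hw : Measurable w) (hw0 : ∀ a, 0 ≤ w a) {B : ℝ}
    (hfB : ∀ᵐ a ∂N, |f a| ≤ B) (hgB : ∀ᵐ a ∂N, |g a| ≤ B)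
    (hwi : Integrable (fun a => Real.exp (w a)) N) :
    Real.log (∫ a, Real.exp (g a - w a) ∂N) - Real.log (∫ a, Real.exp (f a - w a) ∂N)
      - (∫ a, Real.exp (f a - w a) * (g a - f a) ∂N) / (∫ a, Real.exp (f a - w a) ∂N) ≤
    Real.exp (2 * B) * (∫ a, Real.exp (w a) ∂N) * (∫ a, (g a - f a) ^ 2 ∂N) / 2 := by
  have hexpi : ∀ k : α → ℝ, Measurable k → (∀ᵐ a ∂N, |k a| ≤ B) →
      Integrable (fun a => Real.exp (k a - w a)) N := by
    intro k hk hkB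
    refine Integrable.of_bound (by fun_prop) (Real.exp B) ?_
    filter_upwards [hkB] with a ha
    rw [Real.norm_eq_abs, Real.abs_exp]
    exact Real.exp_le_exp.2 (by linarith [hw0 a, (abs_le.1 ha).2])
  have hZf := hexpi f hf hfB
  have hZfpos : 0 < ∫ a, Real.exp (f a - w a) ∂N := integral_exp_pos hZf
  have hZgpos : 0 < ∫ a, Real.exp (g a - w a) ∂N := integral_exp_pos (hexpi g hg hgB)
  have hh : Measurable fun a => g a - f a := hg.sub hf
  have hhB : ∀ᵐ a ∂N, |g a - f a| ≤ 2 * B := by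
    filter_upwards [hfB, hgB] with a h1 h2
    rw [abs_le] at *
    constructor <;> linarith
  have hhi : Integrable (fun a => (g a - f a) ^ 2) N := by
    refine Integrable.of_bound (by fun_prop) ((2 * B) ^ 2) ?_
    filter_upwards [hhB] with a ha
    rw [Real.norm_eq_abs, abs_pow]
    exact pow_le_pow_left₀ (abs_nonneg _) ha 2
  have : IsProbabilityMeasure (N.tilted fun a => f a - w a) := isProbabilityMeasure_tilted hZf
  have key := log_integral_exp_sub_integral_le (N.tilted fun a => f a - w a) hh
    (K := Real.exp (2 * B) * (∫ a, Real.exp (w a) ∂N) * (∫ a, (g a - f a) ^ 2 ∂N))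
    (tilted_absolutelyContinuous N _ hhB) ?_
  · rw [integral_exp_tilted, integral_tilted] at key
    have e1 : ∀ a, ((fun a => f a - w a) + fun a => g a - f a) a = g a - w a := fun a => by
      simp only [Pi.add_apply]; ring
    simp only [e1, smul_eq_mul] at key
    have e2 : ∀ a, Real.exp (f a - w a) / (∫ a, Real.exp (f a - w a) ∂N) * (g a - f a) =
        Real.exp (f a - w a) * (g a - f a) / (∫ a, Real.exp (f a - w a) ∂N) := fun a => by ring
    simp only [e2] at key
    rwa [integral_div, Real.log_div hZgpos.ne' hZfpos.ne'] at key
  · intro u hu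
    rw [tilted_tilted hZf]
    set k : α → ℝ := fun a => f a + u * (g a - f a) with hk
    have e : ((fun a => f a - w a) + fun a => u * (g a - f a)) = fun a => k a - w a := by
      funext a; simp only [Pi.add_apply, hk]; ring
    have hkm : Measurable k := by fun_prop
    have hkB : ∀ᵐ a ∂N, |k a| ≤ B := by
      filter_upwards [hfB, hgB] with a h1 h2
      rw [abs_le] at *
      have := hu.1
      have := hu.2
      constructor <;> simp only [hk] <;> nlinarith
    have hZk := hexpi k hkm hkB
    have hw' : Integrable (fun a => Real.exp (-w a)) N := by
      refine Integrable.of_bound (by fun_prop) 1 (ae_of_all _ fun a => ?_)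
      rw [Real.norm_eq_abs, Real.abs_exp]
      exact Real.exp_le_one_iff.2 (by linarith [hw0 a])
    have hZlow : Real.exp (-B) * (1 / ∫ a, Real.exp (w a) ∂N) ≤
        ∫ a, Real.exp (k a - w a) ∂N := by
      refine (mul_le_mul_of_nonneg_left (one_div_integral_exp_le N hwi hw')
        (Real.exp_pos _).le).trans ?_
      rw [← integral_const_mul]
      refine integral_mono_ae (hw'.const_mul _) hZk ?_
      filter_upwards [hkB] with a ha
      rw [← Real.exp_add]
      exact Real.exp_le_exp.2 (by linarith [(abs_le.1 ha).1])
    rw [e, integral_tilted]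
    set Z := ∫ a, Real.exp (k a - w a) ∂N with hZ
    set A := ∫ a, Real.exp (w a) ∂N with hA
    have hApos : 0 < A := integral_exp_pos hwi
    have hZpos : 0 < Z := integral_exp_pos hZk
    have hratio : Real.exp B / Z ≤ Real.exp (2 * B) * A := by
      rw [div_le_iff₀ hZpos]
      calc Real.exp B = Real.exp (2 * B) * A * (Real.exp (-B) * (1 / A)) := by
            have : Real.exp B = Real.exp (2 * B) * Real.exp (-B) := by
              rw [← Real.exp_add]; ring_nf
            rw [this]; field_simp
        _ ≤ _ := by gcongr
    rw [← integral_const_mul]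
    refine integral_mono_of_nonneg (ae_of_all _ fun a => ?_) (hhi.const_mul _) ?_
    · simp only [Pi.zero_apply, smul_eq_mul]; positivity
    · filter_upwards [hkB] with a ha
      simp only [smul_eq_mul]
      refine mul_le_mul_of_nonneg_right (le_trans ?_ hratio) (sq_nonneg _)
      gcongr
      linarith [hw0 a, (abs_le.1 ha).2]

lemma phiPlus_sub_phiPlus_le {ν : (Fin d → ℝ) → ℝ} {c : (Fin d → ℝ) → (Fin d → ℝ) → ℝ} {ε : ℝ}
    (hε : 0 < ε) (hν0 : ∀ y, 0 ≤ ν y) (hνm : Measurable ν) (hν1 : (∫ y, ν y) = 1)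
    (hc : Measurable (Function.uncurry c)) (hc0 : ∀ x y, 0 ≤ c x y) {B : ℝ}
    {φ φb : (Fin d → ℝ) → ℝ} (hφm : Measurable φ) (hφbm : Measurable φb)
    (hφB : ∀ᵐ y ∂(volume : Measure (Fin d → ℝ)), |φ y| ≤ B)
    (hφbB : ∀ᵐ y ∂(volume : Measure (Fin d → ℝ)), |φb y| ≤ B) {x : Fin d → ℝ}
    (hpos : 0 < ∫ y, Real.exp (φ y - c x y / ε) * ν y)
    (hx : Integrable fun y => Real.exp (c x y / ε) * ν y) :
    phiPlus ν c ε φb x - phiPlus ν c ε φ x -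
        (∫ y, Real.exp (φ y - phiPlus ν c ε φ x - c x y / ε) * ν y * (φb y - φ y)) ≤
      Real.exp (2 * B) * (∫ y, Real.exp (c x y / ε) * ν y) *
        (∫ y, (φb y - φ y) ^ 2 * ν y) / 2 := by
  set N : Measure (Fin d → ℝ) := volume.withDensity fun y => ENNReal.ofReal (ν y) with hN
  have hνi : Integrable ν := by
    by_contra h
    simp [integral_undef h] at hν1
  have hNint : ∀ F : (Fin d → ℝ) → ℝ, ∫ y, F y ∂N = ∫ y, F y * ν y := fun F => by
    rw [hN, integral_withDensity_eq_integral_toReal_smul hνm.ennreal_ofReal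
      (ae_of_all _ fun _ => ENNReal.ofReal_lt_top)]
    simp only [ENNReal.toReal_ofReal (hν0 _), smul_eq_mul, mul_comm]
  have hNac : N ≪ volume := withDensity_absolutelyContinuous _ _
  have : IsProbabilityMeasure N := ⟨by
    rw [hN, withDensity_apply _ MeasurableSet.univ, Measure.restrict_univ,
      ← ofReal_integral_eq_lintegral_ofReal hνi (ae_of_all _ hν0), hν1, ENNReal.ofReal_one]⟩
  have hcx : Measurable fun y => c x y / ε :=
    (hc.comp (measurable_const.prodMk measurable_id)).div_const ε
  have hwi : Integrable (fun y => Real.exp (c x y / ε)) N := by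
    rw [hN, integrable_withDensity_iff hνm.ennreal_ofReal
      (ae_of_all _ fun _ => ENNReal.ofReal_lt_top)]
    simpa only [ENNReal.toReal_ofReal (hν0 _)] using hx
  have key := log_integral_exp_sub_log_integral_exp_le N hφm hφbm hcx
    (fun y => div_nonneg (hc0 x y) hε.le) (hNac hφB) (hNac hφbB) hwi
  simp only [hNint] at key
  have e : ∫ y, Real.exp (φ y - phiPlus ν c ε φ x - c x y / ε) * ν y * (φb y - φ y) =
      (∫ y, Real.exp (φ y - c x y / ε) * (φb y - φ y) * ν y) /
        ∫ y, Real.exp (φ y - c x y / ε) * ν y := by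
    rw [← integral_div]
    refine integral_congr_ae (ae_of_all _ fun y => ?_)
    simp only
    rw [sub_right_comm, Real.exp_sub _ (phiPlus ν c ε φ x), phiPlus, Real.exp_log hpos]
    ring
  rw [e]
  exact key

lemma measurable_phiPlus {ν : (Fin d → ℝ) → ℝ} {c : (Fin d → ℝ) → (Fin d → ℝ) → ℝ} (ε : ℝ)
    (hνm : Measurable ν) (hc : Measurable (Function.uncurry c))
    {φ : (Fin d → ℝ) → ℝ} (hφm : Measurable φ) : Measurable (phiPlus ν c ε φ) := by
  have h : Measurable fun z : (Fin d → ℝ) × (Fin d → ℝ) =>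
      Real.exp (φ z.2 - c z.1 z.2 / ε) * ν z.2 :=
    (((hφm.comp measurable_snd).sub (hc.div_const ε)).exp).mul (hνm.comp measurable_snd)
  exact (h.stronglyMeasurable.integral_prod_right).measurable.log

/-- The first marginal of `π(φ, φ⁺)` is `μ`; in particular `π(φ, φ⁺)` is integrable. -/
lemma integrable_piJoint {μ ν : (Fin d → ℝ) → ℝ} {c : (Fin d → ℝ) → (Fin d → ℝ) → ℝ} {ε : ℝ}
    (hμ0 : ∀ x, 0 ≤ μ x) (hν0 : ∀ y, 0 ≤ ν y) (hμm : Measurable μ) (hνm : Measurable ν)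
    (hμi : Integrable μ) (hc : Measurable (Function.uncurry c))
    {φ : (Fin d → ℝ) → ℝ} (hφm : Measurable φ)
    (hpos : ∀ x, 0 < ∫ y, Real.exp (φ y - c x y / ε) * ν y) :
    Integrable (piJoint μ ν c ε φ) := by
  have hm : Measurable (piJoint μ ν c ε φ) :=
    (((((hφm.comp measurable_snd).sub
      ((measurable_phiPlus ε hνm hc hφm).comp measurable_fst)).sub (hc.div_const ε)).exp).mul
      (hμm.comp measurable_fst)).mul (hνm.comp measurable_snd)
  have hnn : ∀ z, 0 ≤ piJoint μ ν c ε φ z := fun z =>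
    mul_nonneg (mul_nonneg (Real.exp_pos _).le (hμ0 _)) (hν0 _)
  have e : ∀ x y, piJoint μ ν c ε φ (x, y) =
      μ x / (∫ y, Real.exp (φ y - c x y / ε) * ν y) * (Real.exp (φ y - c x y / ε) * ν y) := by
    intro x y
    simp only [piJoint]
    rw [sub_right_comm, Real.exp_sub _ (phiPlus ν c ε φ x), phiPlus, Real.exp_log (hpos x)]
    ring
  have hslice : ∀ x, Integrable fun y => Real.exp (φ y - c x y / ε) * ν y := fun x => by
    by_contra h
    exact (hpos x).ne' (integral_undef h)
  rw [Measure.volume_eq_prod, integrable_prod_iff hm.aestronglyMeasurable]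
  refine ⟨ae_of_all _ fun x => ?_, ?_⟩
  · simp only [e]
    exact (hslice x).const_mul _
  · refine hμi.congr (ae_of_all _ fun x => ?_)
    simp only [Real.norm_eq_abs, abs_of_nonneg (hnn _)]
    simp only [e]
    rw [integral_const_mul, div_mul_cancel₀ _ (hpos x).ne']

/-- `L²(ν)` smoothness of the semi-dual on bounded potentials.
If `c ≥ 0` and `λ(B) < ∞`, then for `‖φ‖_∞, ‖φ̄‖_∞ ≤ B`,
`J(φ̄) − J(φ) − ⟨δJ(φ), φ̄ − φ⟩ ≥ −λ(B)·‖φ̄ − φ‖²_{L²(ν)}/2`. -/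
theorem semiDual_L2nu_smooth
    (μ ν : (Fin d → ℝ) → ℝ) (c : (Fin d → ℝ) → (Fin d → ℝ) → ℝ) (ε : ℝ)
    (hε : 0 < ε) (hμ0 : ∀ x, 0 ≤ μ x) (hν0 : ∀ y, 0 ≤ ν y)
    (hμm : Measurable μ) (hνm : Measurable ν)
    (hμ1 : (∫ x, μ x) = 1) (hν1 : (∫ y, ν y) = 1)
    (hc : Measurable (Function.uncurry c))
    (hc0 : ∀ x y, 0 ≤ c x y)
    (B : ℝ) (hB : 0 < B)
    (hlamfin : Integrable
      (fun z : (Fin d → ℝ) × (Fin d → ℝ) => Real.exp (c z.1 z.2 / ε) * μ z.1 * ν z.2))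
    (φ φb : (Fin d → ℝ) → ℝ) (hφm : Measurable φ) (hφbm : Measurable φb)
    (hφB : ∀ᵐ y ∂(volume : Measure (Fin d → ℝ)), |φ y| ≤ B)
    (hφbB : ∀ᵐ y ∂(volume : Measure (Fin d → ℝ)), |φb y| ≤ B)
    (hpos : ∀ x, 0 < ∫ y, Real.exp (φ y - c x y / ε) * ν y)
    (hposb : ∀ x, 0 < ∫ y, Real.exp (φb y - c x y / ε) * ν y)
    (hJ : Integrable (fun x => phiPlus ν c ε φ x * μ x))
    (hJb : Integrable (fun x => phiPlus ν c ε φb x * μ x))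
    (hip : Integrable (fun y => deltaJ μ ν c ε φ y * (φb y - φ y))) :
    semiDual μ ν c ε φb - semiDual μ ν c ε φ -
        (∫ y, deltaJ μ ν c ε φ y * (φb y - φ y)) ≥
      -(lamB μ ν c ε B * ∫ y, (φb y - φ y) ^ 2 * ν y) / 2 := by
  have hμi : Integrable μ := by
    by_contra h
    simp [integral_undef h] at hμ1
  have hνi : Integrable ν := by
    by_contra h
    simp [integral_undef h] at hν1
  have hhm : Measurable fun y => φb y - φ y := hφbm.sub hφm
  have hhB : ∀ᵐ y ∂(volume : Measure (Fin d → ℝ)), |φb y - φ y| ≤ 2 * B := by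
    filter_upwards [hφB, hφbB] with y h1 h2
    rw [abs_le] at *
    constructor <;> linarith
  have hνφ : Integrable fun y => φ y * ν y :=
    hνi.bdd_mul hφm.aestronglyMeasurable (by simpa [Real.norm_eq_abs] using hφB)
  have hνφb : Integrable fun y => φb y * ν y :=
    hνi.bdd_mul hφbm.aestronglyMeasurable (by simpa [Real.norm_eq_abs] using hφbB)
  have hπ := integrable_piJoint (ε := ε) hμ0 hν0 hμm hνm hμi hc hφm hpos
  have hπh : Integrable (fun z : (Fin d → ℝ) × (Fin d → ℝ) =>
      piJoint μ ν c ε φ z * (φb z.2 - φ z.2)) (volume.prod volume) := by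
    refine Integrable.mul_bdd (c := 2 * B) hπ
      (hhm.comp measurable_snd).aestronglyMeasurable ?_
    simpa [Real.norm_eq_abs] using
      Measure.quasiMeasurePreserving_snd (μ := (volume : Measure (Fin d → ℝ))).ae hhB
  have hswap : ∫ y, piY μ ν c ε φ y * (φb y - φ y) =
      ∫ x, ∫ y, piJoint μ ν c ε φ (x, y) * (φb y - φ y) := by
    rw [integral_integral_swap hπh]
    simp only [piY, integral_mul_const]
  have hpiY : Integrable fun y => piY μ ν c ε φ y * (φb y - φ y) := by
    have := hπh.integral_prod_right
    simpa only [piY, integral_mul_const] using this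
  have hE : Integrable fun x => ∫ y, piJoint μ ν c ε φ (x, y) * (φb y - φ y) :=
    hπh.integral_prod_left
  have hdelta : ∫ y, deltaJ μ ν c ε φ y * (φb y - φ y) =
      (∫ y, φb y * ν y) - (∫ y, φ y * ν y) -
        ∫ x, ∫ y, piJoint μ ν c ε φ (x, y) * (φb y - φ y) := by
    have hdiff : Integrable fun y => φb y * ν y - φ y * ν y := hνφb.sub hνφ
    rw [← hswap, ← integral_sub hνφb hνφ, ← integral_sub hdiff hpiY]
    refine integral_congr_ae (ae_of_all _ fun y => ?_)
    simp only [deltaJ]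
    ring
  set H := ∫ y, (φb y - φ y) ^ 2 * ν y with hH
  have hlam : Integrable (fun z : (Fin d → ℝ) × (Fin d → ℝ) =>
      Real.exp (c z.1 z.2 / ε) * μ z.1 * ν z.2) (volume.prod volume) := hlamfin
  have hJdiff : Integrable fun x => phiPlus ν c ε φb x * μ x - phiPlus ν c ε φ x * μ x :=
    hJb.sub hJ
  have hmain : ∫ x, (phiPlus ν c ε φb x * μ x - phiPlus ν c ε φ x * μ x -
        ∫ y, piJoint μ ν c ε φ (x, y) * (φb y - φ y)) ≤
      ∫ x, Real.exp (2 * B) * H / 2 * ∫ y, Real.exp (c x y / ε) * μ x * ν y := by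
    refine integral_mono_ae (hJdiff.sub hE) (hlam.integral_prod_left.const_mul _) ?_
    filter_upwards [hlam.prod_right_ae] with x hx
    have e1 : ∫ y, piJoint μ ν c ε φ (x, y) * (φb y - φ y) = μ x *
        ∫ y, Real.exp (φ y - phiPlus ν c ε φ x - c x y / ε) * ν y * (φb y - φ y) := by
      rw [← integral_const_mul]
      refine integral_congr_ae (ae_of_all _ fun y => ?_)
      simp only [piJoint]
      ring
    have e2 : ∀ y, Real.exp (c x y / ε) * μ x * ν y =
        μ x * (Real.exp (c x y / ε) * ν y) := fun y => by ring
    simp only [e2] at hx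
    simp only [e1, e2, integral_const_mul]
    rcases (hμ0 x).eq_or_lt with h0 | h0
    · simp [← h0]
    · have hx' : Integrable fun y => Real.exp (c x y / ε) * ν y := by
        simpa [h0.ne'] using hx.const_mul (μ x)⁻¹
      have := mul_le_mul_of_nonneg_left (phiPlus_sub_phiPlus_le hε hν0 hνm hν1 hc hc0
        hφm hφbm hφB hφbB (hpos x) hx') h0.le
      rw [← hH] at this
      linarith
  rw [integral_sub hJdiff hE, integral_sub hJb hJ, integral_const_mul,
    ← integral_prod _ hlam, ← Measure.volume_eq_prod] at hmain
  rw [hdelta, ge_iff_le]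
  simp only [semiDual, lamB]
  linarith
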